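/- Assume ‖A(−H + λ₀)⁻¹‖_{B(𝔉)} < 1. Then 1 − G and 1 − G* have bounded inverses in B(𝔉), and the operator Ĥ₀ defined by dom(Ĥ₀) := {ψ ∈ 𝔉 : ψ − Gψ ∈ dom(H)} and Ĥ₀ψ := λ₀ψ − (1 − G*)(−H + λ₀)(ψ − Gψ) is self-adjoint, with λ₀ ∈ ϱ(Ĥ₀) and (−Ĥ₀ + λ₀)⁻¹ = (1 − G)⁻¹(−H + λ₀)⁻¹(1 − G*)⁻¹; if λ₀ < inf σ(H) then Ĥ₀ ≥ λ₀. Moreover, for every ψ ∈ dom(Ĥ₀): Ĥ₀ψ = λ₀ψ − (−H + λ₀)(ψ − Gψ) + A(ψ − Gψ) (i.e. Ĥ₀ acts as S^× plus the regularized annihilation operator A₀), and if ker(G) = {0} and ran(G) ∩ 𝔥₁ = {0}, then dom(H) ∩ dom(Ĥ₀) = {0}. Finally, if T : dom(T) ⊆ 𝔉 → 𝔉 is symmetric with dom(T) ⊇ dom(Ĥ₀) and Ĥ₀-bounded with relative bound < 1, then Ĥ_T := Ĥ₀ + T is self-adjoint with dom(Ĥ_T) = dom(Ĥ₀), and Ĥ_T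 is bounded from below whenever Ĥ₀ is. -/

import Mathlib

noncomputable section

open scoped ComplexInnerProductSpace
open ContinuousLinearMap Filter

variable {F X : Type*}
  [NormedAddCommGroup F] [InnerProductSpace ℂ F] [CompleteSpace F]
  [NormedAddCommGroup X] [InnerProductSpace ℂ X] [CompleteSpace X]

/-- `W R l z = 1 + (z - l) • R`; the point `z` belongs to the resolvent set of the
self-adjoint operator `H` iff `W R l z` is boundedly invertible, where
`R = (-H + λ₀)⁻¹` and `l = λ₀ ∈ ϱ(H) ∩ ℝ` encode `H`. -/
def W (R : F →L[ℂ] F) (l : ℝ) (z : ℂ) : F →L[ℂ] F := 1 + (z - (l : ℂ)) • R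

/-- The resolvent set `ϱ(H)` of `H`, encoded through `R = (-H + λ₀)⁻¹`. -/
def res (R : F →L[ℂ] F) (l : ℝ) : Set ℂ := {z | IsUnit (W R l z)}

/-- The resolvent `R_z = (-H + z)⁻¹`. -/
def Rz (R : F →L[ℂ] F) (l : ℝ) (z : ℂ) : F →L[ℂ] F := R ∘L Ring.inverse (W R l z)

/-- `G_z = (Σ R_z̄)*`, where the bounded operator `B = Σ ∘ R : 𝔉 →L 𝔛` encodes the
(graph-norm bounded) operator `Σ : 𝔥₁ → 𝔛`. -/
def Gz (R : F →L[ℂ] F) (B : F →L[ℂ] X) (l : ℝ) (z : ℂ) : X →L[ℂ] F :=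
  adjoint (B ∘L Ring.inverse (W R l (starRingEnd ℂ z)))

/-- `(-H + λ₀) ψ`, for `ψ ∈ dom H = ran R`. -/
def Hinv (R : F →L[ℂ] F) (ψ : F) : F := Function.invFun (⇑R) ψ

/-- `Σ ψ`, for `ψ ∈ dom H = ran R`. -/
def SigmaOf (R : F →L[ℂ] F) (B : F →L[ℂ] X) (ψ : F) : X := B (Hinv R ψ)

/-- `Q` is the resolvent `(-K + z)⁻¹` of the (in general unbounded) operator `K`. -/
def IsResolventAt (K : F →ₗ.[ℂ] F) (z : ℂ) (Q : F →L[ℂ] F) : Prop :=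
  (∀ ψ : F, Q ψ ∈ K.domain) ∧
  (∀ (ψ : F) (h : Q ψ ∈ K.domain), z • Q ψ - K ⟨Q ψ, h⟩ = ψ) ∧
  (∀ ψ : K.domain, Q (z • (ψ : F) - K ψ) = (ψ : F))

/-- The resolvent set of the (in general unbounded) operator `K`. -/
def pres (K : F →ₗ.[ℂ] F) : Set ℂ := {z | ∃ Q : F →L[ℂ] F, IsResolventAt K z Q}

/-- A symmetric operator `K` for which `z - K` and `z̄ - K` are surjective is self-adjoint. -/
theorem LinearPMap.IsFormalAdjoint.isSelfAdjoint_of_surjective {K : F →ₗ.[ℂ] F}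
    (hK : K.IsFormalAdjoint K) (z : ℂ)
    (h₁ : ∀ y : F, ∃ φ : K.domain, z • (φ : F) - K φ = y)
    (h₂ : ∀ y : F, ∃ φ : K.domain, starRingEnd ℂ z • (φ : F) - K φ = y) :
    IsSelfAdjoint K := by
  have key (φ ψ : K.domain) :
      ⟪starRingEnd ℂ z • (φ : F) - K φ, (ψ : F)⟫ = ⟪(φ : F), z • (ψ : F) - K ψ⟫ := by
    rw [inner_sub_left, inner_sub_right, inner_smul_left, inner_smul_right, hK,
      Complex.conj_conj]
  have hd : Dense (K.domain : Set F) := by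
    rw [Submodule.dense_iff_topologicalClosure_eq_top, Submodule.topologicalClosure_eq_top_iff,
      Submodule.eq_bot_iff]
    intro w hw
    obtain ⟨φ, rfl⟩ := h₂ w
    obtain ⟨ψ, hψ⟩ := h₁ φ
    have h0 := (key φ ψ).symm.trans (Submodule.inner_left_of_mem_orthogonal ψ.2 hw)
    rw [hψ, inner_self_eq_zero] at h0
    obtain rfl : φ = 0 := Subtype.ext h0
    simp
  rw [LinearPMap.isSelfAdjoint_def]
  have hle := LinearPMap.IsFormalAdjoint.le_adjoint hd hK
  refine (LinearPMap.eq_of_le_of_domain_eq hle (le_antisymm hle.1 fun y hy => ?_)).symm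
  obtain ⟨φ, hφ⟩ := h₂ (starRingEnd ℂ z • y - K.adjoint ⟨y, hy⟩)
  obtain ⟨ψ, hψ⟩ := h₁ (y - φ)
  have h0 := key φ ψ
  rw [hφ, inner_sub_left, LinearPMap.adjoint_isFormalAdjoint hd, inner_smul_left,
    Complex.conj_conj, ← inner_smul_right, ← inner_sub_right, hψ, ← sub_eq_zero,
    ← inner_sub_left, inner_self_eq_zero, sub_eq_zero] at h0
  rw [show y = φ from h0]
  exact φ.2

/-- If `z - K` and `z̄ - K` are bounded below and `K` is self-adjoint, then `K` has a resolvent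
at `z`. -/
theorem IsSelfAdjoint.exists_isResolventAt {K : F →ₗ.[ℂ] F} (hK : IsSelfAdjoint K) (z : ℂ)
    {s : ℝ} (hs : 0 < s) (h₁ : ∀ φ : K.domain, s * ‖(φ : F)‖ ≤ ‖z • (φ : F) - K φ‖)
    (h₂ : ∀ φ : K.domain, s * ‖(φ : F)‖ ≤ ‖starRingEnd ℂ z • (φ : F) - K φ‖) :
    ∃ Q : F →L[ℂ] F, IsResolventAt K z Q := by
  have hd := hK.dense_domain
  have : CompleteSpace K.graph := hK.isClosed.completeSpace_coe
  let e : K.graph →L[ℂ] F :=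
    (z • ContinuousLinearMap.fst ℂ F F - ContinuousLinearMap.snd ℂ F F) ∘L K.graph.subtypeL
  have he (p : K.graph) : e p = z • p.1.1 - p.1.2 := rfl
  have heK (φ : K.domain) : e ⟨(φ, K φ), K.mem_graph φ⟩ = z • (φ : F) - K φ := rfl
  have hsurj_graph (p : K.graph) : ∃ φ : K.domain, p = ⟨(φ, K φ), K.mem_graph φ⟩ := by
    obtain ⟨φ, h1, h2⟩ := K.mem_graph_iff.1 p.2
    exact ⟨φ, Subtype.ext (Prod.ext h1.symm h2.symm)⟩
  have hbound (p : K.graph) : ‖p‖ ≤ (1 + (1 + ‖z‖) / s) * ‖e p‖ := by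
    obtain ⟨φ, rfl⟩ := hsurj_graph p
    rw [heK]
    set N := ‖z • (φ : F) - K φ‖
    have hφ : ‖(φ : F)‖ ≤ N / s := by rw [le_div_iff₀ hs]; linarith [h₁ φ]
    have hKφ : ‖K φ‖ ≤ N + ‖z‖ * ‖(φ : F)‖ := by
      calc ‖K φ‖ = ‖z • (φ : F) - (z • (φ : F) - K φ)‖ := by rw [sub_sub_cancel]
        _ ≤ ‖z • (φ : F)‖ + N := norm_sub_le _ _
        _ = _ := by rw [norm_smul, add_comm]
    have hN : 0 ≤ N := norm_nonneg _
    have hNs : 0 ≤ N / s := by positivity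
    have hz : ‖z‖ * ‖(φ : F)‖ ≤ ‖z‖ * (N / s) := by gcongr
    have hz' : 0 ≤ ‖z‖ * (N / s) := by positivity
    have hexp : (1 + (1 + ‖z‖) / s) * N = N + N / s + ‖z‖ * (N / s) := by ring
    rw [hexp]
    refine max_le (?_ : ‖(φ : F)‖ ≤ _) (?_ : ‖K φ‖ ≤ _) <;> linarith
  have hC : 0 ≤ 1 + (1 + ‖z‖) / s := by positivity
  have hanti : AntilipschitzWith ⟨1 + (1 + ‖z‖) / s, hC⟩ e :=
    e.antilipschitz_of_bound hbound
  have hclosed : IsClosed (Set.range e) := hanti.isClosed_range e.uniformContinuous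
  have hrange : e.range = ⊤ := by
    have hcl : IsClosed (e.range : Set F) := hclosed
    rw [← hcl.submodule_topologicalClosure_eq, Submodule.topologicalClosure_eq_top_iff,
      Submodule.eq_bot_iff]
    intro y hy
    have hform (φ : K.domain) : ⟪starRingEnd ℂ z • y, (φ : F)⟫ = ⟪y, K φ⟫ := by
      have h0 := Submodule.inner_left_of_mem_orthogonal
        (LinearMap.mem_range_self e.toLinearMap ⟨(φ, K φ), K.mem_graph φ⟩) hy
      change ⟪y, z • (φ : F) - K φ⟫ = 0 at h0
      rw [inner_sub_right, inner_smul_right, sub_eq_zero] at h0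
      rw [inner_smul_left, Complex.conj_conj, h0]
    have hy' := LinearPMap.mem_adjoint_domain_of_exists y ⟨_, hform⟩
    have hyK : (y, starRingEnd ℂ z • y) ∈ K.graph := by
      rw [← LinearPMap.isSelfAdjoint_def.1 hK]
      exact (LinearPMap.mem_graph_iff _).2
        ⟨⟨y, hy'⟩, rfl, LinearPMap.adjoint_apply_eq hd _ hform⟩
    obtain ⟨φ, hφ, hKφ⟩ := K.mem_graph_iff.1 hyK
    have h0 := h₂ φ
    dsimp only at hφ hKφ
    rw [hKφ, hφ, sub_self, norm_zero] at h0
    exact norm_le_zero_iff.1 (nonpos_of_mul_nonpos_right h0 hs)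
  let E := ContinuousLinearEquiv.ofBijective e (LinearMap.ker_eq_bot.2 hanti.injective) hrange
  have hEe (y : F) : e (E.symm y) = y := E.apply_symm_apply y
  refine ⟨ContinuousLinearMap.fst ℂ F F ∘L K.graph.subtypeL ∘L (E.symm : F →L[ℂ] K.graph),
    fun y => LinearPMap.mem_domain_of_mem_graph (E.symm y).2, fun y h => ?_, fun φ => ?_⟩
  · have hKy := (LinearPMap.image_iff h).2 (E.symm y).2
    exact (congrArg (z • (E.symm y).1.1 - ·) hKy.symm).trans (hEe y)
  · have h0 : E.symm (z • (φ : F) - K φ) = ⟨(φ, K φ), K.mem_graph φ⟩ := by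
      rw [← heK]
      exact E.symm_apply_apply _
    change (E.symm (z • (φ : F) - K φ)).1.1 = φ
    rw [h0]

/-- A perturbation `T` of `K` with `‖T φ‖ ≤ b ‖(z - K) φ‖`, `b < 1`, is represented by a bounded
operator `D = T (z - K)⁻¹` of norm less than one. -/
theorem IsResolventAt.exists_comp {E : Type*} [NormedAddCommGroup E] [InnerProductSpace ℂ E]
    {K T : E →ₗ.[ℂ] E} {z : ℂ} {Q : E →L[ℂ] E}
    (hQ : IsResolventAt K z Q) (hdom : K.domain ≤ T.domain) {b : ℝ} (hb₀ : 0 ≤ b) (hb : b < 1)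
    (hT : ∀ φ : K.domain, ‖T ⟨φ, hdom φ.2⟩‖ ≤ b * ‖z • (φ : E) - K φ‖) :
    ∃ D : E →L[ℂ] E, ‖D‖ < 1 ∧ ∀ y, D y = T ⟨Q y, hdom (hQ.1 y)⟩ := by
  let D₀ : E →ₗ[ℂ] E := T.toFun ∘ₗ
    LinearMap.codRestrict T.domain Q.toLinearMap fun y => hdom (hQ.1 y)
  refine ⟨D₀.mkContinuous b fun y => ?_,
    (D₀.mkContinuous_norm_le hb₀ _).trans_lt hb, fun y => rfl⟩
  have h := hT ⟨Q y, hQ.1 y⟩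
  rwa [hQ.2.1] at h

theorem IsResolventAt.surjective_sub_add {K T : F →ₗ.[ℂ] F} {z : ℂ} {Q : F →L[ℂ] F}
    (hQ : IsResolventAt K z Q) (hdom : K.domain ≤ T.domain) {D : F →L[ℂ] F} (hD : ‖D‖ < 1)
    (hDT : ∀ y, D y = T ⟨Q y, hdom (hQ.1 y)⟩) (y : F) :
    ∃ φ : (K + T).domain, z • (φ : F) - (K + T) φ = y := by
  obtain ⟨u, hu⟩ := (ContinuousLinearMap.isUnit_iff_bijective.1
    (isUnit_one_sub_of_norm_lt_one hD)).2 y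
  refine ⟨⟨Q u, hQ.1 u, hdom (hQ.1 u)⟩, ?_⟩
  rw [LinearPMap.add_apply, ← sub_sub, hQ.2.1 u (hQ.1 u), ← hDT, ← hu]
  rfl

theorem LinearPMap.IsFormalAdjoint.add {E : Type*} [NormedAddCommGroup E] [InnerProductSpace ℂ E]
    {K T : E →ₗ.[ℂ] E} (hK : K.IsFormalAdjoint K)
    (hT : T.IsFormalAdjoint T) : (K + T).IsFormalAdjoint (K + T) := fun x y => by
  rw [LinearPMap.add_apply, LinearPMap.add_apply, inner_add_left, inner_add_right]
  exact congrArg₂ (· + ·) (hK ⟨x, x.2.1⟩ ⟨y, y.2.1⟩) (hT ⟨x, x.2.2⟩ ⟨y, y.2.2⟩)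

theorem IsSelfAdjoint.isFormalAdjoint {K : F →ₗ.[ℂ] F} (hK : IsSelfAdjoint K) :
    K.IsFormalAdjoint K := by
  have h := LinearPMap.adjoint_isFormalAdjoint hK.dense_domain
  rwa [LinearPMap.isSelfAdjoint_def.1 hK] at h

theorem LinearPMap.IsFormalAdjoint.norm_I_smul_sub_sq {E : Type*} [NormedAddCommGroup E]
    [InnerProductSpace ℂ E] {K : E →ₗ.[ℂ] E}
    (hK : K.IsFormalAdjoint K) (μ : ℝ) (φ : K.domain) :
    ‖((μ : ℂ) * Complex.I) • (φ : E) - K φ‖ ^ 2 = ‖K φ‖ ^ 2 + μ ^ 2 * ‖(φ : E)‖ ^ 2 := by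
  have him : (⟪(φ : E), K φ⟫).im = 0 := by
    have h := congrArg Complex.im (hK φ φ)
    rw [← inner_conj_symm, Complex.conj_im] at h
    linarith
  rw [@norm_sub_sq ℂ, inner_smul_left, norm_smul]
  simp [him, mul_pow]
  ring

theorem sq_norm_add_le_sq_norm_smul_sub {E : Type*} [NormedAddCommGroup E] [InnerProductSpace ℂ E]
    {K : E →ₗ.[ℂ] E} {m : ℝ} (s : ℝ) (hs : 0 ≤ s)
    (hm : ∀ φ : K.domain, m * ‖(φ : E)‖ ^ 2 ≤ (⟪(φ : E), K φ⟫).re) (φ : K.domain) :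
    ‖K φ - (m : ℂ) • (φ : E)‖ ^ 2 + s ^ 2 * ‖(φ : E)‖ ^ 2 ≤
      ‖((m - s : ℝ) : ℂ) • (φ : E) - K φ‖ ^ 2 := by
  have hsplit : ((m - s : ℝ) : ℂ) • (φ : E) - K φ =
      -((s : ℂ) • (φ : E) + (K φ - (m : ℂ) • (φ : E))) := by
    push_cast
    module
  have hre : 0 ≤ (⟪(φ : E), K φ - (m : ℂ) • (φ : E)⟫).re := by
    rw [inner_sub_right, inner_smul_right, inner_self_eq_norm_sq_to_K]
    have := hm φ
    simp [← Complex.ofReal_pow]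
    linarith
  rw [hsplit, norm_neg, @norm_add_sq ℂ, inner_smul_left, norm_smul]
  have := mul_nonneg hs hre
  simp only [Complex.conj_ofReal, Complex.norm_real, Real.norm_eq_abs, mul_pow, sq_abs,
    RCLike.re_to_complex, Complex.re_ofReal_mul]
  linarith

/-- A relatively bounded perturbation with bound `a < 1` is dominated by `z - K` as soon as `z` is
far enough from the spectrum of `K`. -/
theorem exists_relative_bound {a c d : ℝ} (ha₀ : 0 ≤ a) (ha : a < 1) (hc : 0 ≤ c)
    (hd : 0 ≤ d) : ∃ s b : ℝ, 0 < s ∧ 0 ≤ b ∧ b < 1 ∧ ∀ t k x N : ℝ,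
      t ≤ a * k + c * x → k ≤ N + d * x → s * x ≤ N → t ≤ b * N := by
  have h1 : 0 < 1 - a := by linarith
  have h2 : 0 ≤ a * d + c := by positivity
  have hs : 0 < (a * d + c + 1) / (1 - a) := by positivity
  refine ⟨(a * d + c + 1) / (1 - a), a + (a * d + c) / ((a * d + c + 1) / (1 - a)), hs,
    by positivity, ?_, fun t k x N ht hk hx => ?_⟩
  · have : (a * d + c) / ((a * d + c + 1) / (1 - a)) < 1 - a := by
      rw [div_lt_iff₀ hs, mul_div_cancel₀ _ h1.ne']
      linarith
    linarith
  · have hx' : x ≤ N / ((a * d + c + 1) / (1 - a)) := by rw [le_div_iff₀ hs]; linarith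
    calc t ≤ a * k + c * x := ht
      _ ≤ a * (N + d * x) + c * x := by gcongr
      _ = a * N + (a * d + c) * x := by ring
      _ ≤ a * N + (a * d + c) * (N / ((a * d + c + 1) / (1 - a))) := by gcongr
      _ = _ := by ring

/-- The Kato–Rellich theorem. -/
theorem IsSelfAdjoint.add_of_relatively_bounded {K T : F →ₗ.[ℂ] F} (hK : IsSelfAdjoint K)
    (hT : T.IsFormalAdjoint T) (hdom : K.domain ≤ T.domain) {a c : ℝ} (ha₀ : 0 ≤ a)
    (ha : a < 1) (hc : 0 ≤ c)
    (hbd : ∀ φ : K.domain, ‖T ⟨φ, hdom φ.2⟩‖ ≤ a * ‖K φ‖ + c * ‖(φ : F)‖) :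
    IsSelfAdjoint (K + T) := by
  have hsym := hK.isFormalAdjoint
  obtain ⟨s, b, hs, hb₀, hb, H⟩ := exists_relative_bound ha₀ ha hc le_rfl
  have hconj (μ : ℝ) : starRingEnd ℂ ((μ : ℂ) * Complex.I) = ((-μ : ℝ) : ℂ) * Complex.I := by
    simp
  have hlow (μ : ℝ) (hμ : |μ| = s) (φ : K.domain) :
      s * ‖(φ : F)‖ ≤ ‖((μ : ℂ) * Complex.I) • (φ : F) - K φ‖ := by
    refine le_of_sq_le_sq ?_ (norm_nonneg _)
    rw [hsym.norm_I_smul_sub_sq, mul_pow, ← hμ, sq_abs]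
    linarith [sq_nonneg ‖K φ‖]
  have hsurj (μ : ℝ) (hμ : |μ| = s) (y : F) :
      ∃ φ : (K + T).domain, ((μ : ℂ) * Complex.I) • (φ : F) - (K + T) φ = y := by
    obtain ⟨Q, hQ⟩ := hK.exists_isResolventAt ((μ : ℂ) * Complex.I) hs (hlow μ hμ)
      (by rw [hconj]; exact hlow _ (by rwa [abs_neg]))
    obtain ⟨D, hD, hDT⟩ := hQ.exists_comp hdom hb₀ hb fun φ =>
      H _ _ _ _ (hbd φ) (by
        rw [zero_mul, add_zero]
        refine le_of_sq_le_sq ?_ (norm_nonneg _)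
        rw [hsym.norm_I_smul_sub_sq]
        linarith [mul_nonneg (sq_nonneg μ) (sq_nonneg ‖(φ : F)‖)]) (hlow μ hμ φ)
    exact hQ.surjective_sub_add hdom hD hDT y
  refine (hsym.add hT).isSelfAdjoint_of_surjective ((s : ℂ) * Complex.I)
    (hsurj s (abs_of_pos hs)) ?_
  rw [hconj]
  exact hsurj _ (by rw [abs_neg, abs_of_pos hs])

/-- Reid's inequality: if `S` is positive, `D` is a contraction, and `S D` is self-adjoint, then
`S + S D` is positive. -/
theorem ContinuousLinearMap.IsPositive.re_inner_add_nonneg {S D : F →L[ℂ] F}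
    (hS : S.IsPositive) (hD : ‖D‖ ≤ 1) (hSD : ∀ x y, ⟪D x, S y⟫ = ⟪S x, D y⟫) (x : F) :
    0 ≤ (⟪S x, x + D x⟫).re := by
  have hsym (x y : F) : ⟪S x, y⟫ = ⟪x, S y⟫ := hS.isSymmetric x y
  have hSpos : 0 ≤ S := (nonneg_iff_isPositive S).2 hS
  have hsa : IsSelfAdjoint (S ∘L D) := by
    rw [isSelfAdjoint_iff_isSymmetric]
    intro x y
    change ⟪S (D x), y⟫ = ⟪x, S (D y)⟫
    rw [hsym, hSD, hsym]
  have hSsa : adjoint S = S := hS.isSelfAdjoint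
  have hadj : S ∘L D = adjoint D ∘L S := by
    rw [← hsa.adjoint_eq, adjoint_comp, hSsa]
  have hsq : star (S ∘L D) * (S ∘L D) ≤ star S * S := by
    rw [ContinuousLinearMap.le_def]
    refine ⟨((IsSelfAdjoint.star_mul_self S).sub
      (IsSelfAdjoint.star_mul_self (S ∘L D))).isSymmetric, fun x => ?_⟩
    have hin (A : F →L[ℂ] F) : (⟪(star A * A) x, x⟫).re = ‖A x‖ ^ 2 := by
      change (⟪adjoint A (A x), x⟫).re = _
      rw [adjoint_inner_left]
      exact inner_self_eq_norm_sq (𝕜 := ℂ) _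
    have hle : ‖(S ∘L D) x‖ ≤ ‖S x‖ := by
      rw [hadj]
      refine ((adjoint D).le_of_opNorm_le ?_ (S x)).trans_eq (one_mul _)
      rwa [LinearIsometryEquiv.norm_map]
    rw [reApplyInnerSelf_apply, sub_apply, inner_sub_left, map_sub]
    change 0 ≤ (⟪(star S * S) x, x⟫).re - (⟪(star (S ∘L D) * (S ∘L D)) x, x⟫).re
    rw [hin, hin, sub_nonneg]
    gcongr
  have habs : CFC.abs (S ∘L D) ≤ S := by
    exact (CFC.sqrt_le_sqrt _ _ hsq).trans_eq (CFC.abs_of_nonneg S hSpos)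
  have hpos : 0 ≤ S + S ∘L D := by
    have h1 : 0 ≤ CFC.abs (S ∘L D) + S ∘L D := by
      rw [CFC.abs_add_self _ hsa]
      exact nsmul_nonneg (CFC.posPart_nonneg _) 2
    exact h1.trans (by gcongr)
  have h := ((nonneg_iff_isPositive _).1 hpos).re_inner_nonneg_right x
  rw [inner_add_right, hsym, hsym, ← inner_add_right]
  exact h

/-- Semi-boundedness is stable under relatively bounded perturbations. -/
theorem IsSelfAdjoint.exists_lower_bound_add {K T : F →ₗ.[ℂ] F} (hK : IsSelfAdjoint K)
    (hT : T.IsFormalAdjoint T) (hdom : K.domain ≤ T.domain) {a c : ℝ} (ha₀ : 0 ≤ a)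
    (ha : a < 1) (hc : 0 ≤ c)
    (hbd : ∀ φ : K.domain, ‖T ⟨φ, hdom φ.2⟩‖ ≤ a * ‖K φ‖ + c * ‖(φ : F)‖) {m : ℝ}
    (hm : ∀ φ : K.domain, m * ‖(φ : F)‖ ^ 2 ≤ (⟪(φ : F), K φ⟫).re) :
    ∃ m' : ℝ, ∀ φ : (K + T).domain, m' * ‖(φ : F)‖ ^ 2 ≤ (⟪(φ : F), (K + T) φ⟫).re := by
  have hsym := hK.isFormalAdjoint
  obtain ⟨s, b, hs, hb₀, hb, H⟩ := exists_relative_bound ha₀ ha hc (abs_nonneg m)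
  set z : ℝ := m - s
  have hsq := sq_norm_add_le_sq_norm_smul_sub s hs.le hm
  have hlow (φ : K.domain) : s * ‖(φ : F)‖ ≤ ‖(z : ℂ) • (φ : F) - K φ‖ := by
    refine le_of_sq_le_sq ?_ (norm_nonneg _)
    rw [mul_pow]
    linarith [hsq φ, sq_nonneg ‖K φ - (m : ℂ) • (φ : F)‖]
  have hKle (φ : K.domain) :
      ‖K φ‖ ≤ ‖(z : ℂ) • (φ : F) - K φ‖ + |m| * ‖(φ : F)‖ := by
    have h1 : ‖K φ - (m : ℂ) • (φ : F)‖ ≤ ‖(z : ℂ) • (φ : F) - K φ‖ := by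
      refine le_of_sq_le_sq ?_ (norm_nonneg _)
      linarith [hsq φ, mul_nonneg (sq_nonneg s) (sq_nonneg ‖(φ : F)‖)]
    have h2 := norm_add_le (K φ - (m : ℂ) • (φ : F)) ((m : ℂ) • (φ : F))
    rw [sub_add_cancel, norm_smul, Complex.norm_real, Real.norm_eq_abs] at h2
    linarith
  obtain ⟨Q, hQ⟩ := hK.exists_isResolventAt z hs hlow (by rwa [Complex.conj_ofReal])
  obtain ⟨D, hD, hDT⟩ := hQ.exists_comp hdom hb₀ hb fun φ =>
    H _ _ _ _ (hbd φ) (hKle φ) (hlow φ)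
  have hQsym (x y : F) : ⟪Q x, y⟫ = ⟪x, Q y⟫ := by
    have h := hsym ⟨Q x, hQ.1 x⟩ ⟨Q y, hQ.1 y⟩
    nth_rw 1 [← hQ.2.1 y (hQ.1 y)]
    nth_rw 2 [← hQ.2.1 x (hQ.1 x)]
    rw [inner_sub_right, inner_sub_left, inner_smul_left, inner_smul_right,
      Complex.conj_ofReal, ← h]
  have hpos : (-Q).IsPositive := by
    refine ⟨fun x y => ?_, fun y => ?_⟩
    · change ⟪-Q x, y⟫ = ⟪x, -Q y⟫
      rw [inner_neg_left, inner_neg_right, hQsym]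
    · have h := hm ⟨Q y, hQ.1 y⟩
      have hKy : K ⟨Q y, hQ.1 y⟩ = (z : ℂ) • Q y - y := by
        rw [eq_sub_iff_add_eq, ← eq_sub_iff_add_eq', hQ.2.1]
      rw [hKy, inner_sub_right, inner_smul_right, inner_self_eq_norm_sq_to_K] at h
      simp [← Complex.ofReal_pow] at h
      rw [reApplyInnerSelf_apply]
      change 0 ≤ (⟪-Q y, y⟫).re
      rw [inner_neg_left, Complex.neg_re]
      have := mul_nonneg hs.le (sq_nonneg ‖Q y‖)
      linarith
  have hDsym (x y : F) : ⟪(-D) x, (-Q) y⟫ = ⟪(-Q) x, (-D) y⟫ := by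
    simp only [neg_apply, inner_neg_neg, hDT]
    exact hT ⟨Q x, hdom (hQ.1 x)⟩ ⟨Q y, hdom (hQ.1 y)⟩
  refine ⟨z, fun φ => ?_⟩
  set u : F := (z : ℂ) • (φ : F) - K ⟨φ, φ.2.1⟩ with hu
  have hQu : Q u = φ := hQ.2.2 ⟨φ, φ.2.1⟩
  have hDu : D u = T ⟨φ, φ.2.2⟩ := by
    rw [hDT]
    congr 2
  have h := hpos.re_inner_add_nonneg (D := -D) (by rw [norm_neg]; exact hD.le) hDsym u
  have hKT : (K + T) φ = (z : ℂ) • (φ : F) - (u + (-D) u) := by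
    rw [neg_apply, hDu, hu]
    change K ⟨φ, φ.2.1⟩ + T ⟨φ, φ.2.2⟩ = _
    abel
  rw [neg_apply, hQu, inner_neg_left, Complex.neg_re] at h
  rw [hKT, inner_sub_right, inner_smul_right, inner_self_eq_norm_sq_to_K]
  simp [← Complex.ofReal_pow] at h ⊢
  linarith

/-- The operator `l - (1 - G*) R⁻¹ (1 - G)` on its natural domain. -/
def dressedOperator (R G : F →L[ℂ] F) (l : ℝ) (hinj : Function.Injective ⇑R) :
    F →ₗ.[ℂ] F where
  domain := R.toLinearMap.range.comap (1 - G).toLinearMap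
  toFun := (l : ℂ) • Submodule.subtype _ -
    (1 - adjoint G).toLinearMap ∘ₗ
      (LinearEquiv.ofInjective R.toLinearMap hinj).symm.toLinearMap ∘ₗ
        (1 - G).toLinearMap.restrict fun _ h => h

theorem mem_dressedOperator_domain {R G : F →L[ℂ] F} {l : ℝ} {hinj : Function.Injective ⇑R}
    {ψ : F} : ψ ∈ (dressedOperator R G l hinj).domain ↔ ∃ χ, R χ = ψ - G ψ := Iff.rfl

theorem dressedOperator_apply {R G : F →L[ℂ] F} {l : ℝ} {hinj : Function.Injective ⇑R}
    (ψ : (dressedOperator R G l hinj).domain) {χ : F} (hχ : (ψ : F) - G ψ = R χ) :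
    dressedOperator R G l hinj ψ = (l : ℂ) • (ψ : F) - (χ - adjoint G χ) := by
  have h : (LinearEquiv.ofInjective R.toLinearMap hinj).symm ⟨(1 - G) (ψ : F), ψ.2⟩ = χ := by
    rw [LinearEquiv.symm_apply_eq]
    exact Subtype.ext hχ
  change (l : ℂ) • (ψ : F) - (1 - adjoint G)
    ((LinearEquiv.ofInjective R.toLinearMap hinj).symm ⟨(1 - G) (ψ : F), ψ.2⟩) = _
  rw [h]
  rfl

theorem isFormalAdjoint_dressedOperator {R G : F →L[ℂ] F} {l : ℝ} (hR : IsSelfAdjoint R)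
    {hinj : Function.Injective ⇑R} :
    (dressedOperator R G l hinj).IsFormalAdjoint (dressedOperator R G l hinj) := by
  intro x y
  obtain ⟨χ, hχ⟩ := mem_dressedOperator_domain.1 x.2
  obtain ⟨η, hη⟩ := mem_dressedOperator_domain.1 y.2
  rw [dressedOperator_apply x hχ.symm, dressedOperator_apply y hη.symm, inner_sub_left,
    inner_sub_right, inner_smul_left, inner_smul_right, Complex.conj_ofReal, inner_sub_left χ,
    inner_sub_right _ η, adjoint_inner_left, adjoint_inner_right, ← inner_sub_left,
    ← inner_sub_right, ← hχ, ← hη]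
  congr 1
  exact (hR.isSymmetric χ η).symm

theorem isResolventAt_dressedOperator {R G : F →L[ℂ] F} {l : ℝ}
    {hinj : Function.Injective ⇑R} (h₁ : IsUnit (1 - G)) (h₂ : IsUnit (1 - adjoint G)) :
    IsResolventAt (dressedOperator R G l hinj) (l : ℂ)
      (Ring.inverse (1 - G) ∘L R ∘L Ring.inverse (1 - adjoint G)) := by
  have hinv {A : F →L[ℂ] F} (hA : IsUnit A) (x : F) : A (Ring.inverse A x) = x :=
    congrArg (fun f : F →L[ℂ] F => f x) (Ring.mul_inverse_cancel A hA)
  have hinv' {A : F →L[ℂ] F} (hA : IsUnit A) (x : F) : Ring.inverse A (A x) = x :=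
    congrArg (fun f : F →L[ℂ] F => f x) (Ring.inverse_mul_cancel A hA)
  refine ⟨fun ψ => ⟨_, (hinv h₁ _).symm⟩, fun ψ h => ?_, fun ψ => ?_⟩
  · rw [dressedOperator_apply _ (hinv h₁ _), sub_sub_cancel]
    exact hinv h₂ ψ
  · obtain ⟨χ, hχ⟩ := mem_dressedOperator_domain.1 ψ.2
    rw [dressedOperator_apply ψ hχ.symm, sub_sub_cancel]
    change Ring.inverse (1 - G) (R (Ring.inverse (1 - adjoint G) ((1 - adjoint G) χ))) = ψ
    rw [hinv' h₂, hχ]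
    exact hinv' h₁ ψ

theorem isSelfAdjoint_dressedOperator {R G : F →L[ℂ] F} {l : ℝ} (hR : IsSelfAdjoint R)
    {hinj : Function.Injective ⇑R} (h₁ : IsUnit (1 - G)) (h₂ : IsUnit (1 - adjoint G)) :
    IsSelfAdjoint (dressedOperator R G l hinj) := by
  have hQ := isResolventAt_dressedOperator (l := l) (hinj := hinj) h₁ h₂
  have hsurj (y : F) : ∃ φ : (dressedOperator R G l hinj).domain,
      (l : ℂ) • (φ : F) - dressedOperator R G l hinj φ = y :=
    ⟨⟨_, hQ.1 y⟩, hQ.2.1 y _⟩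
  exact (isFormalAdjoint_dressedOperator hR).isSelfAdjoint_of_surjective (l : ℂ) hsurj
    (by rwa [Complex.conj_ofReal])

theorem Gz_self (R : F →L[ℂ] F) (B : F →L[ℂ] X) (l : ℝ) : Gz R B l l = adjoint B := by
  have : W R l (starRingEnd ℂ (l : ℂ)) = 1 := by simp [W]
  rw [Gz, this, Ring.inverse_one]
  rfl

/-- Assume `H` is bounded from below and `‖A (-H + λ₀)⁻¹‖ < 1` (here
`B = A ∘ R` and `G = (A (-H + λ₀)⁻¹)* = adjoint B`).  Then `1 - G` and `1 - G*` have
bounded inverses; the operator `Ĥ₀` with `dom Ĥ₀ = {ψ : ψ - G ψ ∈ dom H}` and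
`Ĥ₀ ψ := λ₀ ψ - (1 - G*)(-H + λ₀)(ψ - G ψ)` is self-adjoint, `λ₀ ∈ ϱ(Ĥ₀)`,
`(-Ĥ₀ + λ₀)⁻¹ = (1 - G)⁻¹ (-H + λ₀)⁻¹ (1 - G*)⁻¹`; if `λ₀ < inf σ(H)` then
`Ĥ₀ ≥ λ₀`.  Moreover `Ĥ₀ ψ = λ₀ ψ - (-H + λ₀)(ψ - G ψ) + A (ψ - G ψ)`, and if
`ker G = {0}` and `ran G ∩ 𝔥₁ = {0}` then `dom H ∩ dom Ĥ₀ = {0}`.  Finally, if `T` is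
symmetric with `dom T ⊇ dom Ĥ₀`, `Ĥ₀`-bounded with relative bound `< 1`, then
`Ĥ_T := Ĥ₀ + T` is self-adjoint with `dom Ĥ_T = dom Ĥ₀`, bounded from below whenever
`Ĥ₀` is. -/
theorem statement18
    (R B : F →L[ℂ] F) (l : ℝ)
    (hR : IsSelfAdjoint R) (hinj : Function.Injective ⇑R)
    (hsemib : ∃ m : ℝ, ∀ χ : F, m * ‖R χ‖ ^ 2 ≤ (⟪R χ, (l : ℂ) • R χ - χ⟫).re)
    (hnorm : ‖B‖ < 1) :
    IsUnit (1 - Gz R B l l) ∧ IsUnit (1 - adjoint (Gz R B l l)) ∧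
    ∃ Hhat0 : F →ₗ.[ℂ] F,
      (Hhat0.domain : Set F) = {ψ | ψ - Gz R B l l ψ ∈ Set.range ⇑R} ∧
      (∀ (ψ : Hhat0.domain) (χ : F),
        (ψ : F) - Gz R B l l (ψ : F) = R χ →
        Hhat0 ψ = (l : ℂ) • (ψ : F) - (χ - adjoint (Gz R B l l) χ)) ∧
      IsSelfAdjoint Hhat0 ∧
      IsResolventAt Hhat0 (l : ℂ)
        (Ring.inverse (1 - Gz R B l l) ∘L R ∘L Ring.inverse (1 - adjoint (Gz R B l l))) ∧
      ((∃ δ : ℝ, 0 < δ ∧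
          ∀ χ : F, (l + δ) * ‖R χ‖ ^ 2 ≤ (⟪R χ, (l : ℂ) • R χ - χ⟫).re) →
        ∀ ψ : Hhat0.domain, l * ‖(ψ : F)‖ ^ 2 ≤ (⟪(ψ : F), Hhat0 ψ⟫).re) ∧
      (∀ (ψ : Hhat0.domain) (χ : F),
        (ψ : F) - Gz R B l l (ψ : F) = R χ →
        Hhat0 ψ = (l : ℂ) • (ψ : F) - χ + B χ) ∧
      (Function.Injective ⇑(Gz R B l l) →
        Set.range ⇑(Gz R B l l) ∩ Set.range ⇑R = {0} →
        Set.range ⇑R ∩ (Hhat0.domain : Set F) = {0}) ∧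
      (∀ T : F →ₗ.[ℂ] F,
        (∀ x y : T.domain, ⟪T x, (y : F)⟫ = ⟪(x : F), T y⟫) →
        Hhat0.domain ≤ T.domain →
        (∃ a : ℝ, a < 1 ∧ ∃ c : ℝ,
          ∀ (ψ : Hhat0.domain) (h : (ψ : F) ∈ T.domain),
            ‖T ⟨(ψ : F), h⟩‖ ≤ a * ‖Hhat0 ψ‖ + c * ‖(ψ : F)‖) →
        (IsSelfAdjoint (Hhat0 + T) ∧ (Hhat0 + T).domain = Hhat0.domain ∧
          ((∃ m : ℝ, ∀ ψ : Hhat0.domain,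
              m * ‖(ψ : F)‖ ^ 2 ≤ (⟪(ψ : F), Hhat0 ψ⟫).re) →
            ∃ m' : ℝ, ∀ ψ : (Hhat0 + T).domain,
              m' * ‖(ψ : F)‖ ^ 2 ≤ (⟪(ψ : F), (Hhat0 + T) ψ⟫).re))) := by
  simp only [Gz_self, adjoint_adjoint]
  have hu₂ : IsUnit (1 - B) := isUnit_one_sub_of_norm_lt_one hnorm
  have hu₁ : IsUnit (1 - adjoint B) :=
    isUnit_one_sub_of_norm_lt_one (by rwa [LinearIsometryEquiv.norm_map])
  have hu₂' : IsUnit (1 - adjoint (adjoint B)) := by rwa [adjoint_adjoint]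
  have happ (ψ : (dressedOperator R (adjoint B) l hinj).domain) (χ : F)
      (h : (ψ : F) - adjoint B (ψ : F) = R χ) :
      dressedOperator R (adjoint B) l hinj ψ = (l : ℂ) • (ψ : F) - (χ - B χ) := by
    rw [dressedOperator_apply ψ h, adjoint_adjoint]
  have hsa := isSelfAdjoint_dressedOperator (l := l) (hinj := hinj) hR hu₁ hu₂'
  refine ⟨hu₁, hu₂, dressedOperator R (adjoint B) l hinj, rfl, happ, hsa, ?_, ?_, ?_, ?_, ?_⟩
  · have h := isResolventAt_dressedOperator (l := l) (hinj := hinj) hu₁ hu₂'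
    rwa [adjoint_adjoint] at h
  · rintro ⟨δ, hδ, hlow⟩ ψ
    obtain ⟨χ, hχ⟩ := mem_dressedOperator_domain.1 ψ.2
    have h := hlow χ
    have hpos := mul_nonneg hδ.le (sq_nonneg ‖R χ‖)
    rw [inner_sub_right, inner_smul_right, inner_self_eq_norm_sq_to_K] at h
    rw [happ ψ χ hχ.symm, inner_sub_right, inner_smul_right, inner_sub_right _ χ,
      ← adjoint_inner_left, ← inner_sub_left, ← hχ, inner_self_eq_norm_sq_to_K]
    simp [← Complex.ofReal_pow] at h ⊢
    linarith
  · intro ψ χ h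
    rw [happ ψ χ h, sub_sub_eq_add_sub, add_sub_right_comm]
  · intro hG hGR
    refine Set.eq_singleton_iff_unique_mem.2 ⟨⟨⟨0, map_zero R⟩, Submodule.zero_mem _⟩, ?_⟩
    rintro _ ⟨⟨χ, rfl⟩, η, hη⟩
    have h0 : adjoint B (R χ) ∈ Set.range (adjoint B) ∩ Set.range R := by
      refine ⟨⟨_, rfl⟩, χ - η, ?_⟩
      change R η = R χ - adjoint B (R χ) at hη
      rw [map_sub, hη, sub_sub_cancel]
    rw [hGR, Set.mem_singleton_iff] at h0
    exact hG (h0.trans (map_zero _).symm)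
  · rintro T hT hdom ⟨a, ha, c, hbd⟩
    have hbd' (ψ : (dressedOperator R (adjoint B) l hinj).domain) :
        ‖T ⟨ψ, hdom ψ.2⟩‖ ≤ max a 0 * ‖dressedOperator R (adjoint B) l hinj ψ‖ +
          max c 0 * ‖(ψ : F)‖ := by
      refine (hbd ψ (hdom ψ.2)).trans ?_
      gcongr <;> exact le_max_left _ _
    have ha' : max a 0 < 1 := max_lt ha one_pos
    refine ⟨hsa.add_of_relatively_bounded hT hdom (le_max_right _ _) ha' (le_max_right _ _) hbd',
      inf_eq_left.2 hdom, ?_⟩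
    rintro ⟨m, hm⟩
    exact hsa.exists_lower_bound_add hT hdom (le_max_right _ _) ha' (le_max_right _ _) hbd' hm
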